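/- arXiv:2410.06018 — 11 statements merged into one kernel-verified Lean document; each statement's English description precedes it below -/
import Mathlib

section
/- Let h : ℂ → ℂ be an entire function. Suppose z : ℝ → ℂ satisfies z'(t) = h(z(t)) for all t ∈ ℝ, Δz : ℝ → ℂ satisfies the variational (sensitivity) equation Δz'(t) = h'(z(t))·Δz(t) for all t ∈ ℝ, and h(z(t)) ≠ 0 for all t ∈ ℝ. Then for all t ∈ ℝ, Δz(t) = (h(z(t)) / h(z(0))) · Δz(0). -/
/-- Sensitivity solution formula for the holomorphic flow `z' = h(z)`:
the solution of the variational equation `Δz' = h'(z)·Δz` is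
`Δz(t) = (h(z(t))/h(z(0)))·Δz(0)`. -/
theorem sensitivity_solution_formula
    (h : ℂ → ℂ) (hh : Differentiable ℂ h)
    (z Δz : ℝ → ℂ)
    (hz : ∀ t : ℝ, HasDerivAt z (h (z t)) t)
    (hΔz : ∀ t : ℝ, HasDerivAt Δz (deriv h (z t) * Δz t) t)
    (hne : ∀ t : ℝ, h (z t) ≠ 0) :
    ∀ t : ℝ, Δz t = (h (z t) / h (z 0)) * Δz 0 := by
  have hc : ∀ t : ℝ, HasDerivAt (fun s => h (z s)) (deriv h (z t) * h (z t)) t := fun t =>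
    HasDerivAt.comp_of_eq (h₂ := h) t (hh (z t)).hasDerivAt (hz t) rfl
  have hq : ∀ t : ℝ, HasDerivAt (fun s => Δz s / h (z s)) 0 t := by
    intro t
    have h1 := (hΔz t).fun_div (hc t) (hne t)
    refine h1.congr_deriv ?_
    rw [div_eq_zero_iff]
    left
    ring
  intro t
  have h2 := is_const_of_deriv_eq_zero (f := fun s => Δz s / h (z s))
    (fun s => (hq s).differentiableAt) (fun s => (hq s).deriv) t 0
  have h3 : Δz t / h (z t) = Δz 0 / h (z 0) := h2
  have h4 : Δz t = Δz t / h (z t) * h (z t) := (div_mul_cancel₀ _ (hne t)).symm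
  rw [h4, h3]
  ring
end

section
/- Let h : ℂ → ℂ be an entire function. Suppose z : ℝ → ℂ satisfies the (real-time) Newton flow equation z'(t) = −h(z(t))/h'(z(t)) for all t ∈ ℝ, where h'(z(t)) ≠ 0 for all t ∈ ℝ. Then the phase of h is conserved along the flow: for every t ∈ ℝ there exists a real number r > 0 such that h(z(t)) = r·h(z(0)). -/
/-- Real-time Newton flow trajectories `z' = -h(z)/h'(z)` are lines of constant
phase of `h`: for every `t` there is `r > 0` with `h(z(t)) = r·h(z(0))`. -/
theorem newton_flow_phase_conserved
    (h : ℂ → ℂ) (hh : Differentiable ℂ h)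
    (z : ℝ → ℂ)
    (hz : ∀ t : ℝ, HasDerivAt z (-(h (z t) / deriv h (z t))) t)
    (hne : ∀ t : ℝ, deriv h (z t) ≠ 0) :
    ∀ t : ℝ, ∃ r : ℝ, 0 < r ∧ h (z t) = (r : ℂ) * h (z 0) := by
  have h1 : ∀ t : ℝ, HasDerivAt (fun s : ℝ => h (z s)) (-h (z t)) t := by
    intro t
    have := (hh (z t)).hasDerivAt.comp_of_eq t (hz t) rfl
    have e : deriv h (z t) * (-(h (z t) / deriv h (z t))) = -h (z t) := by
      have := hne t
      field_simp
    rw [e] at this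
    exact this
  have h2 : ∀ t : ℝ, HasDerivAt (fun s : ℝ => ((Real.exp s : ℝ) : ℂ) * h (z s)) 0 t := by
    intro t
    have := (Real.hasDerivAt_exp t).ofReal_comp.mul (h1 t)
    refine HasDerivAt.congr_deriv this ?_
    ring
  intro t
  have h3 := is_const_of_deriv_eq_zero (fun s => (h2 s).differentiableAt)
    (fun s => (h2 s).deriv) t 0
  simp only [Real.exp_zero, Complex.ofReal_one, one_mul] at h3
  refine ⟨Real.exp (-t), Real.exp_pos _, ?_⟩
  rw [← h3, ← mul_assoc, ← Complex.ofReal_mul, ← Real.exp_add]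
  simp
end

section
/- Let h : ℂ → ℂ be an entire function. Suppose z : ℝ → ℂ and τ : ℝ → ℂ are differentiable and satisfy the complex-time Newton flow relation z'(s) = −(h(z(s))/h'(z(s)))·τ'(s) for all s ∈ [0,1], where h'(z(s)) ≠ 0 for all s ∈ [0,1]. Then h(z(1)) = h(z(0))·exp(−(τ(1) − τ(0))). -/
/-- Newton flow in complex time: along a complex time path `T = τ(s)`, `s ∈ [0,1]`,
solutions of `z'(s) = -(h(z(s))/h'(z(s)))·τ'(s)` satisfy
`h(z(1)) = h(z(0))·exp(-(τ(1) - τ(0)))`. -/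
theorem newton_flow_complex_time_solution
    (h : ℂ → ℂ) (hh : Differentiable ℂ h)
    (z τ : ℝ → ℂ)
    (hzdiff : Differentiable ℝ z) (hτdiff : Differentiable ℝ τ)
    (hflow : ∀ s ∈ Set.Icc (0:ℝ) 1,
      deriv z s = -(h (z s) / deriv h (z s)) * deriv τ s)
    (hne : ∀ s ∈ Set.Icc (0:ℝ) 1, deriv h (z s) ≠ 0) :
    h (z 1) = h (z 0) * Complex.exp (-(τ 1 - τ 0)) := by
  have key : ∀ s ∈ Set.Icc (0:ℝ) 1,
      HasDerivAt (fun s => h (z s) * Complex.exp (τ s)) 0 s := by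
    intro s hs
    have h1 : HasDerivAt (fun s => h (z s)) (deriv h (z s) * deriv z s) s :=
      (hh (z s)).hasDerivAt.comp_of_eq s (hzdiff s).hasDerivAt rfl
    have h2 : HasDerivAt (fun s => Complex.exp (τ s)) (Complex.exp (τ s) * deriv τ s) s :=
      (hτdiff s).hasDerivAt.cexp
    have h3 := h1.mul h2
    have h4 : deriv h (z s) * deriv z s * Complex.exp (τ s)
        + h (z s) * (Complex.exp (τ s) * deriv τ s) = 0 := by
      rw [hflow s hs]
      have := hne s hs
      field_simp
      ring
    rw [h4] at h3
    exact h3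
  have hc := constant_of_has_deriv_right_zero
    (f := fun s => h (z s) * Complex.exp (τ s)) (a := 0) (b := 1)
    (fun s hs => (key s hs).continuousAt.continuousWithinAt)
    (fun s hs => (key s ⟨hs.1, hs.2.le⟩).hasDerivWithinAt) 1 (by simp)
  have hc' : h (z 1) * Complex.exp (τ 1) = h (z 0) * Complex.exp (τ 0) := hc
  have e : -(τ 1 - τ 0) = τ 0 - τ 1 := by ring
  rw [e, Complex.exp_sub, ← mul_div_assoc, ← hc', mul_div_assoc,
    div_self (Complex.exp_ne_zero _), mul_one]
end

section
/- Let h : ℂ → ℂ be an entire function. Suppose z : ℝ → ℂ and τ : ℝ → ℂ are differentiable and satisfy z'(s) = −(h(z(s))/h'(z(s)))·τ'(s) for all s ∈ [0,1], where h'(z(s)) ≠ 0 for all s ∈ [0,1]. If the orbit is periodic with complex period T = τ(1) − τ(0), i.e. z(1) = z(0), and h(z(0)) ≠ 0, then there exists an integer k such that τ(1) − τ(0) = 2πik. In other words, complex periods of periodic orbits of the complex-time Newton flow are integer multiples of 2πi. -/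
/-- Complex periods of periodic orbits of the complex-time Newton flow are
integer multiples of `2πi`. -/
theorem newton_flow_complex_period
    (h : ℂ → ℂ) (hh : Differentiable ℂ h)
    (z τ : ℝ → ℂ)
    (hzdiff : Differentiable ℝ z) (hτdiff : Differentiable ℝ τ)
    (hflow : ∀ s ∈ Set.Icc (0:ℝ) 1,
      deriv z s = -(h (z s) / deriv h (z s)) * deriv τ s)
    (hne : ∀ s ∈ Set.Icc (0:ℝ) 1, deriv h (z s) ≠ 0)
    (hper : z 1 = z 0) (hz0 : h (z 0) ≠ 0) :
    ∃ k : ℤ, τ 1 - τ 0 = 2 * Real.pi * Complex.I * (k : ℂ) := by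
  have hd : ∀ s ∈ Set.Icc (0:ℝ) 1,
      HasDerivAt (fun s => h (z s) * Complex.exp (τ s)) 0 s := by
    intro s hs
    have h1 : HasDerivAt (fun s => h (z s)) (deriv h (z s) * deriv z s) s :=
      (hh (z s)).hasDerivAt.comp s (hzdiff s).hasDerivAt
    have h2 : HasDerivAt (fun s => Complex.exp (τ s)) (Complex.exp (τ s) * deriv τ s) s :=
      (hτdiff s).hasDerivAt.cexp
    have h3 := h1.mul h2
    have hn := hne s hs
    have h4 : deriv h (z s) * deriv z s * Complex.exp (τ s) +
        h (z s) * (Complex.exp (τ s) * deriv τ s) = 0 := by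
      rw [hflow s hs]
      field_simp
      ring
    rw [h4] at h3
    exact h3
  have hc := constant_of_has_deriv_right_zero
    (fun s hs => (hd s hs).continuousAt.continuousWithinAt)
    (fun s hs => (hd s (Set.Ico_subset_Icc_self hs)).hasDerivWithinAt)
    1 (Set.right_mem_Icc.mpr zero_le_one)
  simp only [hper] at hc
  have he := mul_left_cancel₀ hz0 hc
  obtain ⟨k, hk⟩ := Complex.exp_eq_exp_iff_exists_int.mp he
  exact ⟨k, by rw [hk]; ring⟩
end

section
/- Let h : ℂ → ℂ be an entire function. Suppose z : ℝ → ℂ satisfies z'(t) = h(z(t)), p : ℝ → ℂ satisfies p'(t) = −h'(z(t))·p(t), Δz : ℝ → ℂ satisfies Δz'(t) = h'(z(t))·Δz(t), and Δp : ℝ → ℂ satisfies the second variational equation Δp'(t) = −h''(z(t))·p(t)·Δz(t) − h'(z(t))·Δp(t), all for t ∈ ℝ, and h(z(t)) ≠ 0 for all t ∈ ℝ. Then for all t ∈ ℝ, Δp(t) = ( p(0)·Δz(0)·(h'(z(0)) − h'(z(t))) + h(z(0))·Δp(0) ) / h(z(t)). -/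
/-- Solution formula for the second variational (momentum sensitivity) equation
of the Hamiltonian system `z' = h(z)`, `p' = -h'(z)·p`:
`Δp(t) = (p(0)·Δz(0)·(h'(z(0)) - h'(z(t))) + h(z(0))·Δp(0)) / h(z(t))`. -/
theorem momentum_sensitivity_solution_formula
    (h : ℂ → ℂ) (hh : Differentiable ℂ h)
    (z p Δz Δp : ℝ → ℂ)
    (hz : ∀ t : ℝ, HasDerivAt z (h (z t)) t)
    (hp : ∀ t : ℝ, HasDerivAt p (-(deriv h (z t) * p t)) t)
    (hΔz : ∀ t : ℝ, HasDerivAt Δz (deriv h (z t) * Δz t) t)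
    (hΔp : ∀ t : ℝ, HasDerivAt Δp
      (-(deriv (deriv h) (z t) * p t * Δz t) - deriv h (z t) * Δp t) t)
    (hne : ∀ t : ℝ, h (z t) ≠ 0) :
    ∀ t : ℝ, Δp t =
      (p 0 * Δz 0 * (deriv h (z 0) - deriv h (z t)) + h (z 0) * Δp 0) / h (z t) := by
  have hd : Differentiable ℂ (deriv h) := hh.deriv
  have hhz : ∀ t : ℝ, HasDerivAt (fun s => h (z s)) (deriv h (z t) * h (z t)) t :=
    fun t => (hh (z t)).hasDerivAt.comp t (hz t)
  have hdz : ∀ t : ℝ,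
      HasDerivAt (fun s => deriv h (z s)) (deriv (deriv h) (z t) * h (z t)) t :=
    fun t => (hd (z t)).hasDerivAt.comp t (hz t)
  have h1 : ∀ t : ℝ, HasDerivAt (fun s => p s * Δz s) 0 t := fun t => by
    refine ((hp t).mul (hΔz t)).congr_deriv ?_
    ring
  have h2 : ∀ t : ℝ, HasDerivAt
      (fun s => h (z s) * Δp s + (p s * Δz s) * deriv h (z s)) 0 t := fun t => by
    refine (((hhz t).mul (hΔp t)).add ((h1 t).mul (hdz t))).congr_deriv ?_
    ring
  intro t
  have e1 : p t * Δz t = p 0 * Δz 0 :=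
    is_const_of_deriv_eq_zero (fun s => (h1 s).differentiableAt) (fun s => (h1 s).deriv) t 0
  have e2 : h (z t) * Δp t + (p t * Δz t) * deriv h (z t)
      = h (z 0) * Δp 0 + (p 0 * Δz 0) * deriv h (z 0) :=
    is_const_of_deriv_eq_zero (fun s => (h2 s).differentiableAt) (fun s => (h2 s).deriv) t 0
  rw [e1] at e2
  rw [eq_div_iff (hne t)]
  linear_combination e2
end

section
/- Let h : ℂ → ℂ be an entire function. Suppose z : ℝ → ℂ satisfies z'(t) = h(z(t)) for all t ∈ ℝ with h(z(t)) ≠ 0 for all t ∈ ℝ, and Δz¹, Δz² : ℝ → ℂ both satisfy the variational equation Δz'(t) = h'(z(t))·Δz(t) along z. Then for all t ∈ ℝ, Δz¹(t)·Δz²(0) = Δz²(t)·Δz¹(0); in particular the angle between two sensitivity solutions is preserved by time propagation along the holomorphic flow. -/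
/-- Angles between two sensitivity solutions of the variational equation
`Δz' = h'(z)·Δz` along the holomorphic flow `z' = h(z)` are preserved:
`Δz¹(t)·Δz²(0) = Δz²(t)·Δz¹(0)`. -/
theorem sensitivity_angle_preserved
    (h : ℂ → ℂ) (hh : Differentiable ℂ h)
    (z Δz₁ Δz₂ : ℝ → ℂ)
    (hz : ∀ t : ℝ, HasDerivAt z (h (z t)) t)
    (hne : ∀ t : ℝ, h (z t) ≠ 0)
    (hΔz₁ : ∀ t : ℝ, HasDerivAt Δz₁ (deriv h (z t) * Δz₁ t) t)
    (hΔz₂ : ∀ t : ℝ, HasDerivAt Δz₂ (deriv h (z t) * Δz₂ t) t) :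
    ∀ t : ℝ, Δz₁ t * Δz₂ 0 = Δz₂ t * Δz₁ 0 := by
  have key : ∀ w : ℝ → ℂ, (∀ t : ℝ, HasDerivAt w (deriv h (z t) * w t) t) →
      ∀ t : ℝ, w t / h (z t) = w 0 / h (z 0) := by
    intro w hw t
    have hd : ∀ s : ℝ, HasDerivAt (fun s => w s / h (z s)) 0 s := by
      intro s
      have h1 : HasDerivAt (fun s => h (z s)) (deriv h (z s) * h (z s)) s :=
        (hh (z s)).hasDerivAt.comp s (hz s)
      have h2 := (hw s).fun_div h1 (hne s)
      have h3 : (deriv h (z s) * w s * h (z s) - w s * (deriv h (z s) * h (z s)))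
          / h (z s) ^ 2 = 0 := by
        rw [div_eq_zero_iff]
        left
        ring
      rw [h3] at h2
      exact h2
    exact is_const_of_deriv_eq_zero (fun s => (hd s).differentiableAt)
      (fun s => (hd s).deriv) t 0
  intro t
  have e1 := key Δz₁ hΔz₁ t
  have e2 := key Δz₂ hΔz₂ t
  rw [div_eq_div_iff (hne t) (hne 0)] at e1 e2
  apply mul_right_cancel₀ (hne t)
  linear_combination Δz₂ t * e1 - Δz₁ t * e2
end

section
/- Let h : ℂ → ℂ be an entire function. Suppose z : ℝ → ℂ satisfies z'(t) = h(z(t)) for all t ∈ ℝ with h(z(t)) ≠ 0 for all t ∈ ℝ, and p¹, p² : ℝ → ℂ both satisfy the momentum equation p'(t) = −h'(z(t))·p(t) along z. Then for all t ∈ ℝ, p¹(t)·p²(0) = p²(t)·p¹(0); in particular the angle between two momentum solutions is preserved by time propagation along the Hamiltonian flow. -/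
/-- Angles between two momentum solutions of `p' = -h'(z)·p` along the
holomorphic flow `z' = h(z)` are preserved: `p¹(t)·p²(0) = p²(t)·p¹(0)`. -/
theorem momentum_angle_preserved
    (h : ℂ → ℂ) (hh : Differentiable ℂ h)
    (z p₁ p₂ : ℝ → ℂ)
    (hz : ∀ t : ℝ, HasDerivAt z (h (z t)) t)
    (hne : ∀ t : ℝ, h (z t) ≠ 0)
    (hp₁ : ∀ t : ℝ, HasDerivAt p₁ (-(deriv h (z t) * p₁ t)) t)
    (hp₂ : ∀ t : ℝ, HasDerivAt p₂ (-(deriv h (z t) * p₂ t)) t) :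
    ∀ t : ℝ, p₁ t * p₂ 0 = p₂ t * p₁ 0 := by
  have key : ∀ p : ℝ → ℂ, (∀ t : ℝ, HasDerivAt p (-(deriv h (z t) * p t)) t) →
      ∀ t : ℝ, h (z t) * p t = h (z 0) * p 0 := by
    intro p hp t
    have hd : ∀ s : ℝ, HasDerivAt (fun s => h (z s) * p s) 0 s := by
      intro s
      have h1 : HasDerivAt (fun s => h (z s)) (deriv h (z s) * h (z s)) s :=
        HasDerivAt.comp_of_eq s (hh (z s)).hasDerivAt (hz s) rfl
      have h2 := h1.mul (hp s)
      exact h2.congr_deriv (by ring)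
    exact is_const_of_deriv_eq_zero (f := fun s => h (z s) * p s)
      (fun s => (hd s).differentiableAt) (fun s => (hd s).deriv) t 0
  intro t
  have e1 := key p₁ hp₁ t
  have e2 := key p₂ hp₂ t
  apply mul_left_cancel₀ (mul_ne_zero (hne t) (hne 0))
  linear_combination (h (z 0) * p₂ 0) * e1 - (h (z 0) * p₁ 0) * e2
end

section
/- Let k be an integer and let z₀ ∈ ℂ with Im(z₀) = kπ. Then there is no function z : ℝ → ℂ with z(0) = z₀ satisfying z'(t) = cosh(z(t) − 1/2) for all t ≥ 0; that is, every solution of the cosh flow starting on a line Im z = kπ has a finite maximal interval of existence in positive time (these trajectories are positive separatrices). -/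
/-- Solutions of the cosh flow `z' = cosh(z - 1/2)` starting on a line
`Im z = kπ` have a finite maximal interval of existence in positive time:
no global solution on `t ≥ 0` exists (these trajectories are positive
separatrices). -/
theorem cosh_flow_separatrix_finite_existence
    (k : ℤ) (z₀ : ℂ) (him : z₀.im = (k : ℝ) * Real.pi) :
    ¬ ∃ z : ℝ → ℂ, z 0 = z₀ ∧
      ∀ t : ℝ, 0 ≤ t → HasDerivAt z (Complex.cosh (z t - 1/2)) t := by
  rintro ⟨z, h0, hz⟩
  -- the exponential of the shifted solution satisfies a Riccati equation
  obtain ⟨u, hu⟩ : ∃ u : ℝ → ℂ, u = fun t => Complex.exp (z t - 1/2) := ⟨_, rfl⟩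
  have hud : ∀ t : ℝ, 0 ≤ t → HasDerivAt u ((u t ^ 2 + 1) / 2) t := by
    intro t ht
    have h := ((hz t ht).sub_const (1/2 : ℂ)).cexp
    rw [hu]
    convert h using 1
    rw [Complex.cosh, Complex.exp_neg]
    have := Complex.exp_ne_zero (z t - 1/2)
    field_simp
  -- the initial value is real
  obtain ⟨a, ha⟩ : ∃ a : ℝ, u 0 = (a : ℂ) := by
    refine ⟨(u 0).re, ?_⟩
    apply Complex.ext
    · simp
    · rw [hu]
      simp [h0, Complex.exp_im, him, Real.sin_int_mul_pi]
  have hc : ∀ t : ℝ, HasDerivAt (fun t : ℝ => ((Real.cos (t/2) - a * Real.sin (t/2) : ℝ) : ℂ))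
      (((-(Real.sin (t/2) + a * Real.cos (t/2)) / 2 : ℝ)) : ℂ) t := by
    intro t
    have h2 : HasDerivAt (fun t : ℝ => t/2) (1/2) t := (hasDerivAt_id t).div_const 2
    have := (h2.cos.sub (h2.sin.const_mul a)).ofReal_comp
    refine this.congr_deriv ?_
    congr 1
    ring
  have hs : ∀ t : ℝ, HasDerivAt (fun t : ℝ => ((Real.sin (t/2) + a * Real.cos (t/2) : ℝ) : ℂ))
      ((((Real.cos (t/2) - a * Real.sin (t/2)) / 2 : ℝ)) : ℂ) t := by
    intro t
    have h2 : HasDerivAt (fun t : ℝ => t/2) (1/2) t := (hasDerivAt_id t).div_const 2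
    have := (h2.sin.add (h2.cos.const_mul a)).ofReal_comp
    refine this.congr_deriv ?_
    congr 1
    ring
  obtain ⟨G, hG⟩ : ∃ G : ℝ → ℂ, G = fun t : ℝ =>
      u t * ((Real.cos (t/2) - a * Real.sin (t/2) : ℝ) : ℂ)
        - ((Real.sin (t/2) + a * Real.cos (t/2) : ℝ) : ℂ) := ⟨_, rfl⟩
  have hGd : ∀ t : ℝ, 0 ≤ t → HasDerivAt G (u t / 2 * G t) t := by
    intro t ht
    have h := ((hud t ht).mul (hc t)).sub (hs t)
    rw [hG]
    refine h.congr_deriv ?_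
    push_cast
    ring
  have hG0 : G 0 = 0 := by simp [hG, ha]
  obtain ⟨T, hT⟩ : ∃ T : ℝ, T = 2 * (Real.pi / 2 - Real.arctan a) := ⟨_, rfl⟩
  have hT0 : 0 ≤ T := by
    have := Real.arctan_lt_pi_div_two a
    linarith
  obtain ⟨K, hK⟩ : ∃ K : ℝ, ∀ t ∈ Set.Icc 0 T, ‖u t‖ ≤ K :=
    isCompact_Icc.exists_bound_of_continuousOn
      (fun t ht => (hud t ht.1).continuousAt.continuousWithinAt)
  have hGT : G T = 0 := by
    refine eq_zero_of_abs_deriv_le_mul_abs_self_of_eq_zero_right (f := G)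
      (f' := fun t => u t / 2 * G t) (K := K) (a := 0) (b := T)
      (fun t ht => (hGd t ht.1).continuousAt.continuousWithinAt)
      (fun t ht => (hGd t ht.1).hasDerivWithinAt) hG0 ?_ T ⟨hT0, le_rfl⟩
    intro t ht
    have h1 := hK t ⟨ht.1, ht.2.le⟩
    rw [norm_mul, norm_div, Complex.norm_ofNat]
    have := norm_nonneg (u t)
    gcongr
    linarith
  have hT2 : T / 2 = Real.pi / 2 - Real.arctan a := by rw [hT]; ring
  have hcp : 0 < Real.cos (Real.arctan a) := Real.cos_arctan_pos a
  have hsa : Real.sin (Real.arctan a) = a * Real.cos (Real.arctan a) := by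
    rw [← Real.tan_mul_cos hcp.ne', Real.tan_arctan]
  rw [hG] at hGT
  simp only [hT2, Real.cos_pi_div_two_sub, Real.sin_pi_div_two_sub, hsa, sub_self,
    Complex.ofReal_zero, mul_zero, zero_sub, neg_eq_zero, Complex.ofReal_eq_zero] at hGT
  nlinarith [mul_nonneg (sq_nonneg a) hcp.le]
end

section
/- Let m ∈ ℕ, let ρ : Fin m → ℂ, and define the polynomial h(w) := ∏_{n} (w − ρ(n)). Suppose z : ℝ → ℂ satisfies the Newton flow z'(t) = −h(z(t))/h'(z(t)) for all t ∈ ℝ, where h'(z(t)) ≠ 0 for all t ∈ ℝ. Then for all t ∈ ℝ, ∏_{n} (z(t) − ρ(n)) = exp(−t) · ∏_{n} (z(0) − ρ(n)). Equivalently, if z(0) is not one of the roots ρ(n), the solution satisfies the polynomial equation ∏_{n} (z(t) − ρ(n))/(z(0) − ρ(n)) = e^{−t}. -/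
/-- For a polynomial `h(w) = ∏ₙ (w - ρₙ)`, solutions of the Newton flow
`z' = -h(z)/h'(z)` satisfy `∏ₙ (z(t) - ρₙ) = e^{-t} · ∏ₙ (z(0) - ρₙ)`,
i.e. they solve the approximating polynomial equation `Pₘ(z;t,z₀) = 0`. -/
theorem polynomial_newton_flow_product_formula
    (m : ℕ) (ρ : Fin m → ℂ) (h : ℂ → ℂ)
    (hdef : h = fun w => ∏ n : Fin m, (w - ρ n))
    (z : ℝ → ℂ)
    (hz : ∀ t : ℝ, HasDerivAt z (-(h (z t) / deriv h (z t))) t)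
    (hne : ∀ t : ℝ, deriv h (z t) ≠ 0) :
    ∀ t : ℝ, ∏ n : Fin m, (z t - ρ n) =
      Complex.exp (-t) * ∏ n : Fin m, (z 0 - ρ n) := by
  have hcomp : ∀ t : ℝ, HasDerivAt (fun s => h (z s)) (-h (z t)) t := by
    intro t
    have hd : HasDerivAt h (deriv h (z t)) (z t) :=
      (differentiableAt_of_deriv_ne_zero (hne t)).hasDerivAt
    have h1 := HasDerivAt.comp t hd (hz t)
    have h2 : deriv h (z t) * -(h (z t) / deriv h (z t)) = -h (z t) := by
      have := hne t
      field_simp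
    rw [h2] at h1
    exact h1
  have hexp : ∀ t : ℝ, HasDerivAt (fun s : ℝ => Complex.exp (s : ℂ)) (Complex.exp (t : ℂ)) t :=
    fun t => (Complex.hasDerivAt_exp (t : ℂ)).comp_ofReal
  have hg : ∀ t : ℝ, HasDerivAt (fun s : ℝ => Complex.exp (s : ℂ) * h (z s)) 0 t := by
    intro t
    have h1 := (hexp t).mul (hcomp t)
    have h2 : Complex.exp (t : ℂ) * h (z t) + Complex.exp (t : ℂ) * -h (z t) = 0 := by ring
    rw [h2] at h1
    exact h1
  intro t
  have hc := is_const_of_deriv_eq_zero (fun s => (hg s).differentiableAt)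
    (fun s => (hg s).deriv) t 0
  have key : h (z t) = Complex.exp (-t) * h (z 0) := by
    simp only [Complex.ofReal_zero, Complex.exp_zero, one_mul] at hc
    rw [← hc, ← mul_assoc, ← Complex.exp_add]
    simp
  simpa only [hdef] using key
end

section
/- Let U ⊆ ℝ² be open and let h, X : ℂ → ℂ be holomorphic and h ≠ 0 on the corresponding subset of ℂ; write 𝐡 = (h₁,h₂)ᵀ, 𝐗 = (X₁,X₂)ᵀ for the real–imaginary part splittings, J_𝐗 and J_𝐡 for their 2×2 Jacobian matrices with respect to (z₁,z₂), and let Γ^k_{ij} be the Christoffel symbols of the second kind of the metric g_{11} = g_{22} = 1/(h₁²+h₂²), g_{12} = g_{21} = 0 (given by the Koszul formula). Let E be the 2×2 matrix with rows (0,−1) and (1,0), and 𝐡̄ := E𝐡 = (−h₂,h₁)ᵀ (the splitting of ih). Then for each k ∈ {1,2}: (i) Σ_{i,j} h_j X_i Γ^k_{ij} + Σ_j h_j ∂X_k/∂z_j = (J_𝐗 𝐡 − J_𝐡 𝐗)_k, and (ii) Σ_{i,j} h̄_j X_i Γ^k_{ij} + Σ_j h̄_j ∂X_k/∂z_j = (E(J_𝐗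 𝐡 − J_𝐡 𝐗))_k. That is, the covariant derivatives of the Levi-Civita connection satisfy ∇_𝐡 𝐗 = J_𝐗 𝐡 − J_𝐡 𝐗 and ∇_𝐡̄ 𝐗 = E(J_𝐗 𝐡 − J_𝐡 𝐗) in (z₁,z₂)-coordinates. -/
open Complex Matrix

/-- Real part of a holomorphic function, as a function on `ℝ²`. -/
noncomputable def hre (h : ℂ → ℂ) (p : ℝ × ℝ) : ℝ := (h (p.1 + p.2 * Complex.I)).re

/-- Imaginary part of a holomorphic function, as a function on `ℝ²`. -/
noncomputable def him (h : ℂ → ℂ) (p : ℝ × ℝ) : ℝ := (h (p.1 + p.2 * Complex.I)).im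

/-- Component functions of the holomorphic splitting of `F` (0 ↦ Re F, 1 ↦ Im F). -/
noncomputable def vcomp (F : ℂ → ℂ) (i : Fin 2) : ℝ × ℝ → ℝ :=
  if i = 0 then hre F else him F

/-- Partial derivative `∂f/∂z_j` of `f : ℝ² → ℝ`. -/
noncomputable def pd (f : ℝ × ℝ → ℝ) (j : Fin 2) (p : ℝ × ℝ) : ℝ :=
  fderiv ℝ f p (if j = 0 then ((1 : ℝ), (0 : ℝ)) else ((0 : ℝ), (1 : ℝ)))

/-- Coordinate matrix of the `h`-manifold metric. -/
noncomputable def gmet (h : ℂ → ℂ) (i j : Fin 2) (p : ℝ × ℝ) : ℝ :=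
  if i = j then 1 / (hre h p ^ 2 + him h p ^ 2) else 0

/-- Inverse metric. -/
noncomputable def ginv (h : ℂ → ℂ) (i j : Fin 2) (p : ℝ × ℝ) : ℝ :=
  if i = j then hre h p ^ 2 + him h p ^ 2 else 0

/-- Christoffel symbols of the first kind (Koszul formula). -/
noncomputable def christoffelFst (h : ℂ → ℂ) (k i j : Fin 2) (p : ℝ × ℝ) : ℝ :=
  (1 / 2) * (pd (gmet h i k) j p + pd (gmet h j k) i p - pd (gmet h i j) k p)

/-- Christoffel symbols of the second kind. -/
noncomputable def christoffelSnd (h : ℂ → ℂ) (k i j : Fin 2) (p : ℝ × ℝ) : ℝ :=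
  ∑ l : Fin 2, ginv h k l p * christoffelFst h l i j p

/-- `k`-th coordinate of the covariant derivative `∇_Y X` of the Levi-Civita
connection of the `h`-manifold, for component vector fields `Y, X`. -/
noncomputable def covDer (h : ℂ → ℂ) (Y X : Fin 2 → ℝ × ℝ → ℝ) (k : Fin 2)
    (p : ℝ × ℝ) : ℝ :=
  (∑ i : Fin 2, ∑ j : Fin 2, Y j p * X i p * christoffelSnd h k i j p) +
    ∑ j : Fin 2, Y j p * pd (X k) j p

/-- Jacobian matrix of the splitting of `F` with respect to `(z₁, z₂)`. -/
noncomputable def jacMat (F : ℂ → ℂ) (p : ℝ × ℝ) : Matrix (Fin 2) (Fin 2) ℝ :=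
  fun i j => pd (vcomp F i) j p

/-- The rotation matrix `E` (multiplication by `i`). -/
def Emat : Matrix (Fin 2) (Fin 2) ℝ := !![0, -1; 1, 0]

/-- The real-linear identification of the plane with the complex numbers. -/
noncomputable def planeL : ℝ × ℝ →L[ℝ] ℂ :=
  Complex.ofRealCLM.comp (ContinuousLinearMap.fst ℝ ℝ ℝ) +
    (Complex.ofRealCLM.comp (ContinuousLinearMap.snd ℝ ℝ ℝ)).smulRight Complex.I

lemma planeL_apply (p : ℝ × ℝ) : planeL p = p.1 + p.2 * Complex.I := by
  simp [planeL]

lemma hasFDerivAt_plane (F : ℂ → ℂ) (p : ℝ × ℝ)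
    (hF : DifferentiableAt ℂ F (p.1 + p.2 * Complex.I)) :
    HasFDerivAt (fun q : ℝ × ℝ => F (q.1 + q.2 * Complex.I))
      (((fderiv ℂ F (p.1 + p.2 * Complex.I)).restrictScalars ℝ).comp planeL) p := by
  have h1 : HasFDerivAt F ((fderiv ℂ F (p.1 + p.2 * Complex.I)).restrictScalars ℝ) (planeL p) := by
    rw [planeL_apply]
    exact hF.hasFDerivAt.restrictScalars ℝ
  have h2 := h1.comp p planeL.hasFDerivAt
  have e : (F ∘ planeL) = (fun q : ℝ × ℝ => F (q.1 + q.2 * Complex.I)) := by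
    funext q
    simp [planeL_apply]
  rwa [e] at h2

lemma exists_partials (F : ℂ → ℂ) (p : ℝ × ℝ)
    (hF : DifferentiableAt ℂ F (p.1 + p.2 * Complex.I)) :
    ∃ a b : ℝ, DifferentiableAt ℝ (hre F) p ∧ DifferentiableAt ℝ (him F) p ∧
      fderiv ℝ (hre F) p (1, 0) = a ∧ fderiv ℝ (him F) p (1, 0) = b ∧
      fderiv ℝ (hre F) p (0, 1) = -b ∧ fderiv ℝ (him F) p (0, 1) = a := by
  have h := hasFDerivAt_plane F p hF
  have hr : HasFDerivAt (hre F) _ p := Complex.reCLM.hasFDerivAt.comp p h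
  have hi : HasFDerivAt (him F) _ p := Complex.imCLM.hasFDerivAt.comp p h
  have e : fderiv ℂ F (p.1 + p.2 * Complex.I) Complex.I
      = Complex.I * fderiv ℂ F (p.1 + p.2 * Complex.I) 1 := by
    have := (fderiv ℂ F (p.1 + p.2 * Complex.I)).map_smul Complex.I 1
    simpa using this
  refine ⟨(fderiv ℂ F (p.1 + p.2 * Complex.I) 1).re, (fderiv ℂ F (p.1 + p.2 * Complex.I) 1).im,
    hr.differentiableAt, hi.differentiableAt, ?_, ?_, ?_, ?_⟩
  · rw [hr.fderiv]; simp [planeL_apply, -fderiv_eq_smul_deriv]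
  · rw [hi.fderiv]; simp [planeL_apply, -fderiv_eq_smul_deriv]
  · rw [hr.fderiv]; simp [planeL_apply, e, -fderiv_eq_smul_deriv]
  · rw [hi.fderiv]; simp [planeL_apply, e, -fderiv_eq_smul_deriv]

lemma fderiv_conf (u v : ℝ × ℝ → ℝ) (p w : ℝ × ℝ) (hu : DifferentiableAt ℝ u p)
    (hv : DifferentiableAt ℝ v p) (hne : u p ^ 2 + v p ^ 2 ≠ 0) :
    fderiv ℝ (fun q => 1 / (u q ^ 2 + v q ^ 2)) p w =
      -(2 * u p * fderiv ℝ u p w + 2 * v p * fderiv ℝ v p w) / (u p ^ 2 + v p ^ 2) ^ 2 := by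
  have h1 := (hu.hasFDerivAt.pow 2).add (hv.hasFDerivAt.pow 2)
  have h2 := (hasDerivAt_inv hne).comp_hasFDerivAt p h1
  have e : (fun q => 1 / (u q ^ 2 + v q ^ 2)) = (fun x => x⁻¹) ∘ ((fun x => u x ^ 2) + fun x => v x ^ 2) := by
    funext q
    simp
  rw [e, HasFDerivAt.fderiv h2]
  simp
  field_simp
  ring

/-- Covariant derivative of a holomorphic splitting `𝐗` in the directions of the
holomorphic splittings `𝐡` and `𝐡̄ = E𝐡` on the `h`-manifold:
`∇_𝐡 𝐗 = J_𝐗 𝐡 − J_𝐡 𝐗` and `∇_𝐡̄ 𝐗 = E(J_𝐗 𝐡 − J_𝐡 𝐗)`. -/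
theorem hManifold_covariant_derivative_formula
    (U : Set (ℝ × ℝ)) (hU : IsOpen U) (h X : ℂ → ℂ)
    (hh : ∀ w : ℂ, (w.re, w.im) ∈ U → DifferentiableAt ℂ h w)
    (hX : ∀ w : ℂ, (w.re, w.im) ∈ U → DifferentiableAt ℂ X w)
    (hne : ∀ w : ℂ, (w.re, w.im) ∈ U → h w ≠ 0)
    (p : ℝ × ℝ) (hp : p ∈ U) :
    (∀ k : Fin 2, covDer h (vcomp h) (vcomp X) k p =
      (jacMat X p *ᵥ (fun j => vcomp h j p) -
        jacMat h p *ᵥ (fun j => vcomp X j p)) k) ∧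
    (∀ k : Fin 2, covDer h (vcomp (fun w => Complex.I * h w)) (vcomp X) k p =
      (Emat *ᵥ (jacMat X p *ᵥ (fun j => vcomp h j p) -
        jacMat h p *ᵥ (fun j => vcomp X j p))) k) := by
  set z : ℂ := p.1 + p.2 * Complex.I with hz
  have hzU : (z.re, z.im) ∈ U := by simpa [hz] using hp
  obtain ⟨a, b, hd1, hd2, e1, e2, e3, e4⟩ := exists_partials h p (hh z hzU)
  obtain ⟨c, d, -, -, f1, f2, f3, f4⟩ := exists_partials X p (hX z hzU)
  have hN : hre h p ^ 2 + him h p ^ 2 ≠ 0 := by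
    intro h0
    apply hne z hzU
    have h1 : hre h p = 0 := by nlinarith [sq_nonneg (hre h p), sq_nonneg (him h p)]
    have h2 : him h p = 0 := by nlinarith [sq_nonneg (hre h p), sq_nonneg (him h p)]
    exact Complex.ext h1 h2
  have g0 : ∀ w, fderiv ℝ (fun q => 1 / (hre h q ^ 2 + him h q ^ 2)) p w = _ :=
    fun w => fderiv_conf _ _ p w hd1 hd2 hN
  have gd : ∀ i, gmet h i i = fun q => 1 / (hre h q ^ 2 + him h q ^ 2) := by
    intro i; funext q; simp [gmet]
  have go : ∀ i j, i ≠ j → gmet h i j = fun q => 0 := by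
    intro i j hij; funext q; simp [gmet, hij]
  have p1 : ∀ i, pd (gmet h i i) 0 p = -(2 * hre h p * a + 2 * him h p * b) /
      (hre h p ^ 2 + him h p ^ 2) ^ 2 := by
    intro i; rw [gd, pd, g0]; simp [e1, e2]
  have p2 : ∀ i, pd (gmet h i i) 1 p = -(2 * hre h p * (-b) + 2 * him h p * a) /
      (hre h p ^ 2 + him h p ^ 2) ^ 2 := by
    intro i; rw [gd, pd, g0]; simp [e3, e4]
  have p3 : ∀ j, pd (gmet h 0 1) j p = 0 := by
    intro j; rw [go 0 1 (by decide), pd]; simp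
  have p4 : ∀ j, pd (gmet h 1 0) j p = 0 := by
    intro j; rw [go 1 0 (by decide), pd]; simp
  have i1 : hre (fun w => Complex.I * h w) p = -him h p := by simp [hre, him]
  have i2 : him (fun w => Complex.I * h w) p = hre h p := by simp [hre, him]
  have q1 : pd (hre h) 0 p = a := by simpa [pd] using e1
  have q2 : pd (him h) 0 p = b := by simpa [pd] using e2
  have q3 : pd (hre h) 1 p = -b := by simpa [pd] using e3
  have q4 : pd (him h) 1 p = a := by simpa [pd] using e4
  have r1 : pd (hre X) 0 p = c := by simpa [pd] using f1
  have r2 : pd (him X) 0 p = d := by simpa [pd] using f2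
  have r3 : pd (hre X) 1 p = -d := by simpa [pd] using f3
  have r4 : pd (him X) 1 p = c := by simpa [pd] using f4
  have v0 : ∀ F, vcomp F 0 = hre F := fun F => by simp [vcomp]
  have v1 : ∀ F, vcomp F 1 = him F := fun F => by simp [vcomp]
  have n00 : ginv h 0 0 p = hre h p ^ 2 + him h p ^ 2 := by simp [ginv]
  have n11 : ginv h 1 1 p = hre h p ^ 2 + him h p ^ 2 := by simp [ginv]
  have n01 : ginv h 0 1 p = 0 := by simp [ginv]
  have n10 : ginv h 1 0 p = 0 := by simp [ginv]
  constructor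
  · rw [Fin.forall_fin_two]
    constructor <;>
    · simp only [covDer, christoffelSnd, christoffelFst, Fin.sum_univ_two, Pi.sub_apply,
        Matrix.mulVec, dotProduct, jacMat, v0, v1, p1, p2, p3, p4, q1, q2, q3, q4,
        r1, r2, r3, r4, n00, n01, n10, n11]
      field_simp
      ring
  · rw [Fin.forall_fin_two]
    constructor <;>
    · simp only [covDer, christoffelSnd, christoffelFst, Fin.sum_univ_two, Pi.sub_apply,
        Matrix.mulVec, dotProduct, jacMat, v0, v1, p1, p2, p3, p4, q1, q2, q3, q4,
        r1, r2, r3, r4, n00, n01, n10, n11, i1, i2, Emat, Matrix.of_apply, Matrix.cons_val_zero,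
        Matrix.cons_val_one, Matrix.cons_val', Matrix.cons_val_fin_one]
      field_simp
      ring
end

section
/- Let U ⊆ ℝ² be open, let h : ℂ → ℂ be holomorphic with h ≠ 0 on the corresponding subset of ℂ, with splitting 𝐡 = (h₁,h₂)ᵀ, let Γ^k_{ij} be the Christoffel symbols of the second kind of the metric g_{11} = g_{22} = 1/(h₁²+h₂²), g_{12} = g_{21} = 0, and let 𝐡̄ = (−h₂,h₁)ᵀ. Let a, b ∈ ℝ, let A be the 2×2 matrix with rows (a,−b) and (b,a), and define the vector field 𝐗 := A𝐡, i.e. X₁ = a·h₁ − b·h₂ and X₂ = b·h₁ + a·h₂. Then 𝐗 is parallel along both 𝐡 and 𝐡̄: for each k ∈ {1,2}, Σ_{i,j} h_j X_i Γ^k_{ij} + Σ_j h_j ∂X_k/∂z_j = 0 and Σ_{i,j} h̄_j X_i Γ^k_{ij} + Σ_j h̄_j ∂X_k/∂z_j = 0, i.e. ∇_𝐡 𝐗 = 0 and ∇_𝐡̄ 𝐗 = 0. In particular (a = 1, b = 0 and 𝐗 = 𝐡̄), the real- and imaginary-time solution curves of the holomorphic flow of h are geodesics of the h-manifold, and the holomorphic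 splittings of the sensitivity solutions Δz(z) = (Δz₀/h(z₀))·h(z) are parallel vector fields on the h-manifold. -/
open Complex Matrix

theorem aux_fderiv (h : ℂ → ℂ) (p : ℝ × ℝ)
    (hd : DifferentiableAt ℂ h (p.1 + p.2 * Complex.I)) :
    ∃ u v : ℝ, HasFDerivAt (hre h)
      (u • ContinuousLinearMap.fst ℝ ℝ ℝ - v • ContinuousLinearMap.snd ℝ ℝ ℝ) p ∧
      HasFDerivAt (him h)
      (v • ContinuousLinearMap.fst ℝ ℝ ℝ + u • ContinuousLinearMap.snd ℝ ℝ ℝ) p := by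
  set c := deriv h (p.1 + p.2 * Complex.I) with hc
  have h1 : HasFDerivAt h _ (p.1 + p.2 * Complex.I : ℂ) :=
    hd.hasDerivAt.hasFDerivAt.restrictScalars ℝ
  have hL : HasFDerivAt (fun q : ℝ × ℝ => (q.1 + q.2 * Complex.I : ℂ))
      (Complex.ofRealCLM.comp (ContinuousLinearMap.fst ℝ ℝ ℝ) +
        (ContinuousLinearMap.snd ℝ ℝ ℝ).smulRight Complex.I) p := by
    convert (Complex.ofRealCLM.comp (ContinuousLinearMap.fst ℝ ℝ ℝ) +
        (ContinuousLinearMap.snd ℝ ℝ ℝ).smulRight Complex.I).hasFDerivAt (x := p) using 1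
    ext q <;> simp
  have h2 := HasFDerivAt.comp p h1 hL
  refine ⟨c.re, c.im, ?_, ?_⟩
  · have h3 := Complex.reCLM.hasFDerivAt.comp p h2
    refine HasFDerivAt.congr_fderiv h3 ?_
    ext <;> simp [hc]
  · have h3 := Complex.imCLM.hasFDerivAt.comp p h2
    refine HasFDerivAt.congr_fderiv h3 ?_
    ext <;> simp [hc]

/-- The vector fields `𝐗 = A𝐡` with `A` the rotation-scaling matrix given by
`a, b ∈ ℝ` are parallel along both `𝐡` and `𝐡̄` on the `h`-manifold:
`∇_𝐡 𝐗 = 0` and `∇_𝐡̄ 𝐗 = 0`. In particular the real- and imaginary-time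
trajectories of the holomorphic flow of `h` are geodesics, and the holomorphic
splittings of the sensitivity solutions `Δz(z) = (Δz₀/h(z₀))·h(z)` are parallel
vector fields on the `h`-manifold. -/
theorem hManifold_sensitivity_parallel
    (U : Set (ℝ × ℝ)) (hU : IsOpen U) (h : ℂ → ℂ)
    (hh : ∀ w : ℂ, (w.re, w.im) ∈ U → DifferentiableAt ℂ h w)
    (hne : ∀ w : ℂ, (w.re, w.im) ∈ U → h w ≠ 0)
    (a b : ℝ) (X : Fin 2 → ℝ × ℝ → ℝ)
    (hX0 : X 0 = fun p => a * hre h p - b * him h p)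
    (hX1 : X 1 = fun p => b * hre h p + a * him h p)
    (p : ℝ × ℝ) (hp : p ∈ U) :
    (∀ k : Fin 2, covDer h (vcomp h) X k p = 0) ∧
    (∀ k : Fin 2, covDer h (vcomp (fun w => Complex.I * h w)) X k p = 0) := by
  have hw : ((p.1 + p.2 * Complex.I : ℂ).re, (p.1 + p.2 * Complex.I : ℂ).im) ∈ U := by
    simpa using hp
  obtain ⟨u, v, hr, hi⟩ := aux_fderiv h p (hh _ hw)
  have hn : hre h p ^ 2 + him h p ^ 2 ≠ 0 := by
    have h0 := hne _ hw
    intro h1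
    apply h0
    apply Complex.ext
    · change hre h p = 0
      nlinarith [sq_nonneg (hre h p), sq_nonneg (him h p)]
    · change him h p = 0
      nlinarith [sq_nonneg (hre h p), sq_nonneg (him h p)]
  have hg := (hasDerivAt_inv hn).comp_hasFDerivAt p ((hr.pow 2).add (hi.pow 2))
  have hgd : ∀ i, gmet h i i = fun q => (hre h q ^ 2 + him h q ^ 2)⁻¹ := by
    intro i; funext q; simp [gmet]
  have hgo : ∀ i j, i ≠ j → gmet h i j = fun q => 0 := by
    intro i j hij; funext q; simp [gmet, hij]
  have p0 := ((hr.const_mul a).sub (hi.const_mul b)).fderiv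
  have p1 := ((hr.const_mul b).add (hi.const_mul a)).fderiv
  have hI0 : hre (fun w => Complex.I * h w) p = - him h p := by simp [hre, him]
  have hI1 : him (fun w => Complex.I * h w) p = hre h p := by simp [hre, him]
  have e0 : ∀ j, pd (X 0) j p = if j = 0 then a * u - b * v else - a * v - b * u := by
    intro j
    rw [hX0, pd]
    erw [p0]
    fin_cases j <;> simp <;> ring
  have e1 : ∀ j, pd (X 1) j p = if j = 0 then b * u + a * v else - b * v + a * u := by
    intro j
    rw [hX1, pd]
    erw [p1]
    fin_cases j <;> simp
  have eg : ∀ i j, pd (gmet h i i) j p = if j = 0 then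
      -(2 * (hre h p * u + him h p * v)) / (hre h p ^ 2 + him h p ^ 2) ^ 2 else
      -(2 * (- hre h p * v + him h p * u)) / (hre h p ^ 2 + him h p ^ 2) ^ 2 := by
    intro i j
    rw [hgd, pd]
    erw [hg.fderiv]
    fin_cases j <;> simp <;> field_simp <;> ring
  have eo : ∀ i j k, i ≠ j → pd (gmet h i j) k p = 0 := by
    intro i j k hij
    rw [hgo i j hij, pd]; simp
  have x0 : X 0 p = a * hre h p - b * him h p := by rw [hX0]
  have x1 : X 1 p = b * hre h p + a * him h p := by rw [hX1]
  have o1 := fun k => eo 0 1 k (by decide)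
  have o2 := fun k => eo 1 0 k (by decide)
  constructor
  · intro k
    fin_cases k <;>
    · simp [covDer, christoffelSnd, christoffelFst, ginv, vcomp, Fin.sum_univ_two, e0, e1, eg,
        o1, o2, x0, x1]
      field_simp
      ring
  · intro k
    fin_cases k <;>
    · simp [covDer, christoffelSnd, christoffelFst, ginv, vcomp, Fin.sum_univ_two, e0, e1, eg,
        o1, o2, x0, x1, hI0, hI1]
      field_simp
      ring
end
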